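/- Let Γ ⊆ ℝ² be a compact convex set of diameter 1, let M be a positive integer, and let K ⊆ Γ be a closed convex set of area S with S > 100/M. Then there exists a triangle T with all three vertices in the lattice (1/M)·ℤ² such that T ⊆ K and the area of T is at least S/100. -/

import Mathlib

open MeasureTheory Set Filter

noncomputable section

abbrev Pt : Type := ℝ × ℝ

/-- A finite point set is in general position: no three distinct points are collinear. -/
def GenPos (X : Finset Pt) : Prop :=
  ∀ a ∈ X, ∀ b ∈ X, ∀ c ∈ X, a ≠ b → a ≠ c → b ≠ c → ¬ Collinear ℝ ({a, b, c} : Set Pt)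

/-- `e` is an edge of `X`: an unordered pair of distinct points of `X`. -/
def IsEdgeOf (X : Finset Pt) (e : Sym2 Pt) : Prop :=
  ¬ e.IsDiag ∧ ∀ p ∈ e, p ∈ X

/-- The closed segment joining the two points of an unordered pair. -/
def edgeSeg (e : Sym2 Pt) : Set Pt :=
  Sym2.lift ⟨fun u v => segment ℝ u v, fun u v => segment_symm ℝ u v⟩ e

/-- `M` is a non-crossing perfect matching of `X`: a partition of `X` into unordered pairs
whose closed segments are pairwise disjoint. -/
def IsNCMatching (X : Finset Pt) (M : Finset (Sym2 Pt)) : Prop :=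
  (∀ e ∈ M, IsEdgeOf X e) ∧
  (∀ p ∈ X, ∃! e, e ∈ M ∧ p ∈ e) ∧
  (M : Set (Sym2 Pt)).Pairwise fun e f => Disjoint (edgeSeg e) (edgeSeg f)

/-- The matching `M` avoids the edge set `S`. -/
def Avoids (M S : Finset (Sym2 Pt)) : Prop := ∀ e ∈ M, e ∉ S

/-- The square lattice with spacing `1/M`. -/
def latticePts (M : ℕ) : Set Pt := {p | ∃ a b : ℤ, p = ((a : ℝ) / M, (b : ℝ) / M)}

/-- Vertical slices of a convex planar set are order-connected. -/
theorem Convex.ordConnected_slice {K : Set Pt} (hK : Convex ℝ K) (x : ℝ) :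
    {y : ℝ | (x, y) ∈ K}.OrdConnected := by
  apply Convex.ordConnected
  intro y hy z hz a b ha hb hab
  have h := hK hy hz ha hb hab
  have hx : a * x + b * x = x := by rw [← add_mul, hab, one_mul]
  simpa [hx] using h

/-- A convex set containing a triangle with a vertical side contains its vertical chords. -/
theorem Convex.mem_of_mem_vertical_chord {K : Set Pt} (hK : Convex ℝ K) {x p q x' r t y : ℝ}
    (hp : (x, p) ∈ K) (hq : (x, q) ∈ K) (hr : (x', r) ∈ K) (ht0 : 0 ≤ t) (ht1 : t ≤ 1)
    (hy : y ∈ Icc ((1 - t) * p + t * r) ((1 - t) * q + t * r)) :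
    (x + t * (x' - x), y) ∈ K := by
  have key : ∀ z, (x, z) ∈ K → (x + t * (x' - x), (1 - t) * z + t * r) ∈ K := by
    intro z hz
    have h := hK hz hr (sub_nonneg.2 ht1) ht0 (by ring)
    have hx : (1 - t) * x + t * x' = x + t * (x' - x) := by ring
    simpa [hx] using h
  exact (hK.ordConnected_slice _).out (key p hp) (key q hq) hy

/-- A lower bound for the area of a triangle with a vertical side: half its actual area. -/
theorem le_volume_triangle {x p q x' r : ℝ} (hx : x ≠ x') (hpq : p ≤ q) :
    |x' - x| * (q - p) / 4 ≤
      (volume (convexHull ℝ ({(x, p), (x, q), (x', r)} : Set Pt))).toReal := by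
  set T := convexHull ℝ ({(x, p), (x, q), (x', r)} : Set Pt) with hT
  have hd : x' - x ≠ 0 := sub_ne_zero.2 hx.symm
  have hsub : ({(x, p), (x, q), (x', r)} : Set Pt) ⊆ T := subset_convexHull ℝ _
  have hfin : volume T ≠ ⊤ :=
    ((Set.toFinite _).isCompact_convexHull ℝ).measure_lt_top.ne
  set m := (x + x') / 2 with hm
  let f : ℝ → ℝ := fun z => p + (z - x) / (x' - x) * (r - p)
  let s : Set ℝ := Ioo (min x m) (max x m)
  have hf : Measurable f := by fun_prop
  have hreg : regionBetween f (fun z => f z + (q - p) / 2) s ⊆ T := by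
    rintro ⟨z, y⟩ ⟨hz, hy⟩
    have ht : 0 ≤ (z - x) / (x' - x) ∧ (z - x) / (x' - x) ≤ 1 / 2 := by
      rcases lt_or_gt_of_ne hx with h | h
      · have hxm : x ≤ m := by linarith
        simp only [s, min_eq_left hxm, max_eq_right hxm, mem_Ioo] at hz
        have h' : 0 < x' - x := by linarith
        exact ⟨div_nonneg (by linarith) h'.le, by rw [div_le_iff₀ h']; linarith⟩
      · have hxm : m ≤ x := by linarith
        simp only [s, min_eq_right hxm, max_eq_left hxm, mem_Ioo] at hz
        have h' : x' - x < 0 := by linarith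
        exact ⟨div_nonneg_of_nonpos (by linarith) h'.le, by
          rw [div_le_iff_of_neg h']; linarith⟩
    have hzt : z = x + (z - x) / (x' - x) * (x' - x) := by field_simp; ring
    simp only [f, mem_Ioo] at hy
    generalize (z - x) / (x' - x) = t at ht hzt hy
    rw [hzt]
    refine (convex_convexHull ℝ _).mem_of_mem_vertical_chord (p := p) (q := q) (r := r)
      (hsub (by simp)) (hsub (by simp)) (hsub (by simp)) ht.1 (by linarith) ⟨?_, ?_⟩
    · nlinarith
    · nlinarith [mul_nonneg (sub_nonneg.2 ht.2) (sub_nonneg.2 hpq)]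
  have hvol : volume (regionBetween f (fun z => f z + (q - p) / 2) s) =
      ENNReal.ofReal (|x' - x| * (q - p) / 4) := by
    rw [Measure.volume_eq_prod,
      volume_regionBetween_eq_lintegral hf.aemeasurable (by fun_prop) measurableSet_Ioo]
    have hlen : max x m - min x m = |x' - x| / 2 := by
      rw [max_sub_min_eq_abs', hm, show x - (x + x') / 2 = -((x' - x) / 2) by ring, abs_neg,
        abs_div, abs_two]
    simp only [Pi.sub_apply, add_sub_cancel_left, lintegral_const, Measure.restrict_apply_univ,
      Real.volume_Ioo, hlen]
    rw [← ENNReal.ofReal_mul (by linarith)]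
    congr 1
    ring
  have h := measure_mono (μ := volume) hreg
  rw [hvol] at h
  exact (ENNReal.ofReal_le_iff_le_toReal hfin).1 h

/-- If a line is traversed with speed at least `n` mesh widths, each parameter interval of length
`1 / n` contains a multiple of the mesh width. -/
theorem exists_int_div_eq_add_mul {M : ℝ} (hM : 0 < M) {x d n : ℝ} (hn : 0 < n)
    (hd : n ≤ M * |d|) (u : ℝ) :
    ∃ t, u ≤ t ∧ t ≤ u + 1 / n ∧ ∃ i : ℤ, (i : ℝ) / M = x + t * d := by
  have hd0 : d ≠ 0 := by rintro rfl; simp at hd; linarith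
  have main : ∀ i : ℤ, 0 ≤ (i - M * (x + u * d)) / (M * d) →
      |i - M * (x + u * d)| ≤ 1 →
      ∃ t, u ≤ t ∧ t ≤ u + 1 / n ∧ ∃ i : ℤ, (i : ℝ) / M = x + t * d := by
    intro i h0 h1
    refine ⟨u + (i - M * (x + u * d)) / (M * d), by linarith, ?_, i, by field_simp; ring⟩
    have h2 : (i - M * (x + u * d)) / (M * d) ≤ 1 / n := by
      rw [← abs_of_nonneg h0, abs_div, abs_mul, abs_of_pos hM]
      gcongr
    linarith
  rcases lt_or_gt_of_ne hd0 with h | h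
  · have h1 := Int.floor_le (M * (x + u * d))
    have h2 := Int.lt_floor_add_one (M * (x + u * d))
    exact main ⌊M * (x + u * d)⌋
      (div_nonneg_of_nonpos (by linarith) (mul_neg_of_pos_of_neg hM h).le)
      (abs_le.2 ⟨by linarith, by linarith⟩)
  · have h1 := Int.le_ceil (M * (x + u * d))
    have h2 := Int.ceil_lt_add_one (M * (x + u * d))
    exact main ⌈M * (x + u * d)⌉ (div_nonneg (by linarith) (mul_pos hM h).le)
      (abs_le.2 ⟨by linarith, by linarith⟩)

/-- A planar set in a vertical strip whose slices have length at most `c` has area at most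
`c` times the width of the strip. -/
theorem volume_le_of_slices {K : Set Pt} (hK : MeasurableSet K) {x₀ x₁ c : ℝ}
    (hc : 0 ≤ c) (hx : x₀ ≤ x₁) (hstrip : ∀ z ∈ K, z.1 ∈ Icc x₀ x₁)
    (hslice : ∀ x a b, (x, a) ∈ K → (x, b) ∈ K → b - a ≤ c) :
    (volume K).toReal ≤ c * (x₁ - x₀) := by
  refine ENNReal.toReal_le_of_le_ofReal (mul_nonneg hc (sub_nonneg.2 hx)) ?_
  rw [Measure.volume_eq_prod, Measure.prod_apply hK]
  calc ∫⁻ x, volume (Prod.mk x ⁻¹' K)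
      ≤ ∫⁻ x, (Icc x₀ x₁).indicator (fun _ => ENNReal.ofReal c) x := by
        refine lintegral_mono fun x => ?_
        by_cases hxI : x ∈ Icc x₀ x₁
        · rw [indicator_of_mem hxI]
          refine (Real.volume_le_diam _).trans (Metric.ediam_le fun a ha b hb => ?_)
          rw [edist_dist]
          refine ENNReal.ofReal_le_ofReal (abs_sub_le_iff.2 ⟨?_, ?_⟩)
          · exact hslice x b a hb ha
          · exact hslice x a b ha hb
        · have : Prod.mk x ⁻¹' K = ∅ :=
            eq_empty_of_forall_notMem fun y hy => hxI (hstrip _ hy)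
          simp [this]
    _ = ENNReal.ofReal (c * (x₁ - x₀)) := by
        rw [lintegral_indicator_const measurableSet_Icc, Real.volume_Icc,
          ← ENNReal.ofReal_mul hc]

/-- A convex set containing a large triangle with a vertical side contains a lattice triangle
of comparable area. -/
theorem Convex.exists_lattice_triangle {K : Set Pt} (hK : Convex ℝ K) {M : ℕ} (hM : 0 < M)
    {x p q x' r : ℝ} (hp : (x, p) ∈ K) (hq : (x, q) ∈ K) (hr : (x', r) ∈ K)
    (hH : 50 ≤ M * (q - p)) (hd : 50 ≤ M * |x' - x|) :
    ∃ a b c : Pt, a ∈ latticePts M ∧ b ∈ latticePts M ∧ c ∈ latticePts M ∧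
      convexHull ℝ ({a, b, c} : Set Pt) ⊆ K ∧
      |x' - x| * (q - p) / 25 ≤ (volume (convexHull ℝ ({a, b, c} : Set Pt))).toReal := by
  have hM' : (0 : ℝ) < M := Nat.cast_pos.2 hM
  obtain ⟨t, ht0, ht1, i, hi⟩ :=
    exists_int_div_eq_add_mul hM' (x := x) (d := x' - x) (n := 50) (by norm_num) hd 0
  obtain ⟨s, hs0, hs1, j, hj⟩ :=
    exists_int_div_eq_add_mul hM' (x := x) (d := x' - x) (n := 50) (by norm_num) hd (4 / 5)
  norm_num at ht1 hs1
  have hmesh : 50 * (1 / (M : ℝ)) ≤ q - p := by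
    rw [mul_one_div, div_le_iff₀ hM']; linarith
  have hmesh0 : 0 < 1 / (M : ℝ) := by positivity
  have hlow : ∀ y : ℝ, ∃ k : ℤ, y ≤ (k : ℝ) / M ∧ (k : ℝ) / M ≤ y + 1 / M := by
    intro y
    refine ⟨⌈M * y⌉, ?_, ?_⟩
    · rw [le_div_iff₀ hM']; linarith [Int.le_ceil (M * y)]
    · rw [div_le_iff₀ hM', add_mul, one_div, inv_mul_cancel₀ hM'.ne']
      linarith [Int.ceil_lt_add_one (M * y)]
  obtain ⟨k, hk0, hk1⟩ := hlow ((1 - t) * p + t * r)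
  obtain ⟨l, hl0, hl1⟩ := hlow ((1 - t) * q + t * r - 1 / M)
  obtain ⟨m, hm0, hm1⟩ := hlow ((1 - s) * p + s * r)
  have htH : 49 / 50 * (q - p) ≤ (1 - t) * (q - p) := by
    apply mul_le_mul_of_nonneg_right <;> linarith
  have hsH : 9 / 50 * (q - p) ≤ (1 - s) * (q - p) := by
    apply mul_le_mul_of_nonneg_right <;> linarith
  have hgap : 47 / 50 * (q - p) ≤ (l : ℝ) / M - (k : ℝ) / M := by linarith
  have hwidth : 39 / 50 * |x' - x| ≤ |(j : ℝ) / M - (i : ℝ) / M| := by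
    rw [hi, hj, show x + s * (x' - x) - (x + t * (x' - x)) = (s - t) * (x' - x) by ring, abs_mul,
      abs_of_nonneg (by linarith : 0 ≤ s - t)]
    gcongr
    linarith
  have hd0 : 0 < |x' - x| := by
    by_contra! h
    nlinarith
  refine ⟨((i : ℝ) / M, (k : ℝ) / M), ((i : ℝ) / M, (l : ℝ) / M), ((j : ℝ) / M, (m : ℝ) / M),
    ⟨i, k, rfl⟩, ⟨i, l, rfl⟩, ⟨j, m, rfl⟩, ?_, ?_⟩
  · refine convexHull_min ?_ hK
    rintro z (rfl | rfl | rfl)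
    · rw [hi]
      exact hK.mem_of_mem_vertical_chord hp hq hr ht0 (by linarith) ⟨hk0, by linarith⟩
    · rw [hi]
      exact hK.mem_of_mem_vertical_chord hp hq hr ht0 (by linarith) ⟨by linarith, by linarith⟩
    · rw [hj]
      exact hK.mem_of_mem_vertical_chord hp hq hr (by linarith) (by linarith)
        ⟨hm0, by linarith⟩
  · have hij : (i : ℝ) / M ≠ (j : ℝ) / M := by
      intro h
      rw [h, sub_self, abs_zero] at hwidth
      linarith
    refine le_trans ?_ (le_volume_triangle hij (by linarith))
    have := mul_le_mul hwidth hgap (by linarith) (abs_nonneg _)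
    nlinarith [mul_nonneg hd0.le (by linarith : 0 ≤ q - p)]

/-- inscribed lattice triangle: every closed convex subset `K`, of area
`S > 100/M`, of a compact convex set of diameter `1` contains a lattice triangle of area at
least `S/100`. -/
theorem inscribed_lattice_triangle (Γ : Set Pt) (hΓc : IsCompact Γ) (hΓconv : Convex ℝ Γ)
    (hΓdiam : Metric.diam Γ = 1) (M : ℕ) (hM : 0 < M)
    (K : Set Pt) (hKΓ : K ⊆ Γ) (hKcl : IsClosed K) (hKconv : Convex ℝ K)
    (S : ℝ) (hS : S = (volume K).toReal) (hSbig : 100 / (M : ℝ) < S) :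
    ∃ a b c : Pt, a ∈ latticePts M ∧ b ∈ latticePts M ∧ c ∈ latticePts M ∧
      convexHull ℝ ({a, b, c} : Set Pt) ⊆ K ∧
      S / 100 ≤ (volume (convexHull ℝ ({a, b, c} : Set Pt))).toReal := by
  have hM' : (0 : ℝ) < M := Nat.cast_pos.2 hM
  have hS0 : 0 < S := lt_trans (by positivity) hSbig
  have hKc : IsCompact K := hΓc.of_isClosed_subset hKcl hKΓ
  have hKne : K.Nonempty := by
    rw [nonempty_iff_ne_empty]
    rintro rfl
    simp [hS] at hS0
  obtain ⟨u, huK, hu⟩ := hKc.exists_isMinOn hKne continuous_fst.continuousOn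
  obtain ⟨v, hvK, hv⟩ := hKc.exists_isMaxOn hKne continuous_fst.continuousOn
  have hdist : ∀ z ∈ K, ∀ z' ∈ K, dist z z' ≤ 1 := fun z hz z' hz' =>
    hΓdiam ▸ Metric.dist_le_diam_of_mem hΓc.isBounded (hKΓ hz) (hKΓ hz')
  have hstrip : ∀ z ∈ K, z.1 ∈ Icc u.1 v.1 := fun z hz => ⟨hu hz, hv hz⟩
  have huv : u.1 ≤ v.1 := hu hvK
  have hw1 : v.1 - u.1 ≤ 1 :=
    (le_abs_self _).trans ((le_max_left _ _).trans (hdist v hvK u huK))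
  have hSw : S ≤ v.1 - u.1 := by
    have h := volume_le_of_slices hKcl.measurableSet zero_le_one huv hstrip
      fun x a b ha hb =>
        (le_abs_self _).trans ((le_max_right _ _).trans (hdist (x, b) hb (x, a) ha))
    linarith
  have hw0 : 0 < v.1 - u.1 := by linarith
  obtain ⟨x, p, q, hp, hq, hpq⟩ :
      ∃ x p q, (x, p) ∈ K ∧ (x, q) ∈ K ∧ S / (2 * (v.1 - u.1)) < q - p := by
    by_contra! hcon
    have h := volume_le_of_slices hKcl.measurableSet (by positivity) huv hstrip hcon
    have : S / (2 * (v.1 - u.1)) * (v.1 - u.1) = S / 2 := by field_simp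
    linarith
  obtain ⟨z, hz, hzx⟩ : ∃ z ∈ K, (v.1 - u.1) / 2 ≤ |z.1 - x| := by
    rcases le_total ((v.1 - u.1) / 2) (v.1 - x) with h | h
    · exact ⟨v, hvK, h.trans (le_abs_self _)⟩
    · exact ⟨u, huK, le_trans (by linarith) (neg_le_abs _)⟩
  have hSM : 100 < S * M := (div_lt_iff₀ hM').1 hSbig
  have hpq' : S < 2 * (v.1 - u.1) * (q - p) := by
    rwa [div_lt_iff₀ (by positivity), mul_comm] at hpq
  have hqp0 : 0 < q - p := lt_trans (by positivity) hpq
  have hHS : S / 2 ≤ q - p := by nlinarith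
  obtain ⟨a, b, c, ha, hb, hc, hsub, harea⟩ :=
    hKconv.exists_lattice_triangle hM hp hq (show (z.1, z.2) ∈ K from hz)
      (by nlinarith) (by nlinarith)
  refine ⟨a, b, c, ha, hb, hc, hsub, le_trans ?_ harea⟩
  nlinarith
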